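/- Let $V$ be a Hilbert space and $f \in BV([0,T]; \mathbb{C})$ (a complex-valued function of bounded variation on $[0,T]$). Then for every $\beta \in [0, 1/2)$, $f$ belongs to $H^\beta(0,T)$, i.e. $\int_0^T \int_0^T \frac{|f(t)-f(s)|^2}{|t-s|^{1+2\beta}}\,ds\,dt < \infty$; moreover there exists a constant $C(\beta, T)$ independent of $f$ such that $\|f\|_{H^\beta(0,T)} \le C(\beta,T)\,(\|f\|_{L^1(0,T)} + |f(0)| + |f(T)| + V_0^T(f))$, where $V_0^T(f)$ denotes the total variation of $f$ on $[0,T]$. -/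

import Mathlib

open MeasureTheory Set

/-- The `L¹` modulus of continuity of a monotone function of oscillation at most `V` is at most
`V * |h|`. -/
lemma Monotone.lintegral_abs_sub_translate_le {v : ℝ → ℝ} (hv : Monotone v) {V : ℝ}
    (hV : ∀ x y, |v x - v y| ≤ V) {a b : ℝ} (hab : a ≤ b) (h : ℝ) :
    ∫⁻ t in Ioo a b, ENNReal.ofReal |v (t + h) - v t| ≤ ENNReal.ofReal (V * |h|) := by
  have hi : ∀ c d, IntervalIntegrable v volume c d := fun c d => hv.intervalIntegrable
  have hvh : Monotone fun t => v (t + h) := fun x y hxy => hv (by linarith)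
  have hih : IntervalIntegrable (fun t => v (t + h)) volume a b := hvh.intervalIntegrable
  have key : |∫ t in a..b, (v (t + h) - v t)| ≤ V * |h| := by
    have hba : ∀ c, IntervalIntegrable (fun x => v (x + c)) volume 0 h := fun c =>
      Monotone.intervalIntegrable fun x y hxy => hv (by linarith)
    have : ∫ t in a..b, (v (t + h) - v t) = ∫ x in (0 : ℝ)..h, (v (x + b) - v (x + a)) := by
      rw [intervalIntegral.integral_sub hih (hi a b),
        intervalIntegral.integral_sub (hba b) (hba a)]
      simp only [intervalIntegral.integral_comp_add_right, zero_add]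
      rw [intervalIntegral.integral_interval_sub_interval_comm' (hi _ _) (hi _ _) (hi _ _),
        add_comm h b, add_comm h a]
    rw [this, ← Real.norm_eq_abs]
    simpa using intervalIntegral.norm_integral_le_of_norm_le_const (a := 0) (b := h)
      (f := fun x => v (x + b) - v (x + a)) (C := V) fun x _ => hV _ _
  have habs : ∫ t in a..b, |v (t + h) - v t| = |∫ t in a..b, (v (t + h) - v t)| := by
    rcases le_total 0 h with hh | hh
    · have h0 : ∀ t, 0 ≤ v (t + h) - v t := fun t => sub_nonneg.2 (hv (by linarith))
      rw [abs_of_nonneg (intervalIntegral.integral_nonneg hab fun t _ => h0 t)]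
      exact intervalIntegral.integral_congr fun t _ => abs_of_nonneg (h0 t)
    · have h0 : ∀ t, 0 ≤ -(v (t + h) - v t) := fun t => by
        have := hv (show t + h ≤ t by linarith)
        linarith
      rw [← abs_neg, ← intervalIntegral.integral_neg,
        abs_of_nonneg (intervalIntegral.integral_nonneg hab fun t _ => h0 t)]
      exact intervalIntegral.integral_congr fun t _ =>
        abs_of_nonpos (neg_nonneg.1 (h0 t))
  have hint : IntegrableOn (fun t => |v (t + h) - v t|) (Ioo a b) :=
    ((intervalIntegrable_iff_integrableOn_Ioo_of_le hab).1 (hih.sub (hi a b))).abs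
  rw [← ofReal_integral_eq_lintegral_ofReal hint (ae_of_all _ fun t => abs_nonneg _),
    ← integral_Ioc_eq_integral_Ioo, ← intervalIntegral.integral_of_le hab, habs]
  exact ENNReal.ofReal_le_ofReal key

/-- The variation of a function over `[a, b] ∩ (-∞, x]`, as a function of `x`, is monotone,
has oscillation at most the total variation, and its increments dominate those of the function. -/
lemma BoundedVariationOn.exists_monotone_dominating {E : Type*} [PseudoMetricSpace E] {f : ℝ → E}
    {a b : ℝ} (hf : BoundedVariationOn f (Icc a b)) :
    ∃ v : ℝ → ℝ, Monotone v ∧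
      (∀ x y, |v x - v y| ≤ (eVariationOn f (Icc a b)).toReal) ∧
      ∀ x ∈ Icc a b, ∀ y ∈ Icc a b, dist (f x) (f y) ≤ |v x - v y| := by
  have hfin : ∀ x y, eVariationOn f (Icc a b ∩ Icc x y) ≠ ⊤ := fun x y =>
    ne_top_of_le_ne_top hf (eVariationOn.mono f inter_subset_left)
  have hmono : Monotone fun x => (eVariationOn f (Icc a b ∩ Icc a x)).toReal := fun x y hxy =>
    ENNReal.toReal_mono (hfin a y)
      (eVariationOn.mono f (inter_subset_inter_right _ (Icc_subset_Icc_right hxy)))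
  refine ⟨_, hmono, fun x y => ?_, ?_⟩
  · have hle : ∀ x, (eVariationOn f (Icc a b ∩ Icc a x)).toReal
        ≤ (eVariationOn f (Icc a b)).toReal := fun x =>
      ENNReal.toReal_mono hf (eVariationOn.mono f inter_subset_left)
    have hnn : ∀ x, 0 ≤ (eVariationOn f (Icc a b ∩ Icc a x)).toReal :=
      fun x => ENNReal.toReal_nonneg
    exact abs_sub_le_of_nonneg_of_le (hnn x) (hle x) (hnn y) (hle y)
  · intro x hx y hy
    wlog hxy : x ≤ y generalizing x y
    · rw [dist_comm, abs_sub_comm]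
      exact this y hy x hx (le_of_not_ge hxy)
    have hadd := congrArg ENNReal.toReal (eVariationOn.Icc_add_Icc f hx.1 hxy hx)
    rw [ENNReal.toReal_add (hfin _ _) (hfin _ _)] at hadd
    have hd : dist (f x) (f y) ≤ (eVariationOn f (Icc a b ∩ Icc x y)).toReal :=
      BoundedVariationOn.dist_le (hfin x y) ⟨hx, le_rfl, hxy⟩ ⟨hy, hxy, le_rfl⟩
    rw [abs_sub_comm]
    exact (hd.trans (by linarith)).trans (le_abs_self _)

lemma lintegral_Ioo_neg_abs_rpow_lt_top (T : ℝ) {r : ℝ} (hr : -1 < r) :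
    ∫⁻ h in Ioo (-T) T, ENNReal.ofReal (|h| ^ r) < ⊤ := by
  rcases le_total T 0 with hT | hT
  · simp [Ioo_eq_empty (show ¬ -T < T by linarith)]
  have hpos : IntervalIntegrable (fun h : ℝ => |h| ^ r) volume 0 T :=
    (intervalIntegral.intervalIntegrable_rpow' hr).congr fun h hh => by
      rw [uIoc_of_le hT] at hh
      simp [abs_of_pos hh.1]
  have hneg : IntervalIntegrable (fun h : ℝ => |h| ^ r) volume (-T) 0 := by
    simpa using ((IntervalIntegrable.iff_comp_neg (by finiteness)).1 hpos).symm
  exact ((intervalIntegrable_iff_integrableOn_Ioo_of_le (by linarith)).1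
    (hneg.trans hpos)).lintegral_lt_top

/-- Substituting `s = t + h` in a double integral over a square and exchanging the integrals. -/
lemma lintegral_Ioo_lintegral_Ioo_le_translate {F : ℝ → ℝ → ENNReal}
    (hF : Measurable (Function.uncurry F)) (T : ℝ) :
    ∫⁻ t in Ioo 0 T, ∫⁻ s in Ioo 0 T, F t s
      ≤ ∫⁻ h in Ioo (-T) T, ∫⁻ t in Ioo 0 T, F t (t + h) := by
  have hFt : Measurable (Function.uncurry fun t h => F t (t + h)) :=
    hF.comp (measurable_fst.prodMk (measurable_fst.add measurable_snd))
  rw [← lintegral_lintegral_swap hFt.aemeasurable]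
  refine setLIntegral_mono' measurableSet_Ioo fun t ht => ?_
  rw [← lintegral_indicator measurableSet_Ioo, ← lintegral_indicator measurableSet_Ioo,
    ← lintegral_add_left_eq_self _ t]
  refine lintegral_mono fun h => ?_
  by_cases hh : t + h ∈ Ioo 0 T
  · have : h ∈ Ioo (-T) T := ⟨by linarith [hh.1, ht.2], by linarith [hh.2, ht.1]⟩
    simp [hh, this]
  · simp [hh]

/-- The squared Slobodeckij seminorm of a function of bounded variation. -/
lemma BoundedVariationOn.lintegral_slobodeckij_le {f : ℝ → ℂ} {T : ℝ} (hT : 0 ≤ T)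
    (hf : BoundedVariationOn f (Icc 0 T)) (β : ℝ) :
    ∫⁻ t in Ioo (0:ℝ) T, ∫⁻ s in Ioo (0:ℝ) T,
        ENNReal.ofReal (‖f t - f s‖ ^ 2 / |t - s| ^ (1 + 2 * β))
      ≤ ENNReal.ofReal ((eVariationOn f (Icc 0 T)).toReal ^ 2) *
        ∫⁻ h in Ioo (-T) T, ENNReal.ofReal (|h| ^ (-(2 * β))) := by
  obtain ⟨v, hv, hV, hfv⟩ := hf.exists_monotone_dominating
  set V := (eVariationOn f (Icc 0 T)).toReal
  have hV0 : 0 ≤ V := ENNReal.toReal_nonneg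
  have hmeas : Measurable v := hv.measurable
  let F : ℝ → ℝ → ENNReal := fun t s =>
    ENNReal.ofReal (V / |s - t| ^ (1 + 2 * β)) * ENNReal.ofReal |v s - v t|
  have hF : Measurable (Function.uncurry F) := by
    unfold F Function.uncurry
    fun_prop
  calc _ ≤ ∫⁻ t in Ioo (0:ℝ) T, ∫⁻ s in Ioo (0:ℝ) T, F t s := by
        refine setLIntegral_mono' measurableSet_Ioo fun t ht =>
          setLIntegral_mono' measurableSet_Ioo fun s hs => ?_
        simp only [F]
        rw [← ENNReal.ofReal_mul (by positivity)]
        refine ENNReal.ofReal_le_ofReal ?_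
        rw [div_mul_eq_mul_div, abs_sub_comm s t, abs_sub_comm (v s), sq]
        have hd := hfv t (Ioo_subset_Icc_self ht) s (Ioo_subset_Icc_self hs)
        rw [dist_eq_norm] at hd
        gcongr
        exact hd.trans (hV _ _)
    _ ≤ ∫⁻ h in Ioo (-T) T, ∫⁻ t in Ioo 0 T, F t (t + h) :=
        lintegral_Ioo_lintegral_Ioo_le_translate hF T
    _ ≤ ∫⁻ h in Ioo (-T) T, ENNReal.ofReal (V ^ 2) * ENNReal.ofReal (|h| ^ (-(2 * β))) := by
        refine lintegral_mono fun h => ?_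
        simp only [F, add_sub_cancel_left]
        rw [lintegral_const_mul _ (by fun_prop)]
        refine (mul_le_mul_right (hv.lintegral_abs_sub_translate_le hV hT h) _).trans ?_
        rw [← ENNReal.ofReal_mul (by positivity), ← ENNReal.ofReal_mul (by positivity)]
        refine ENNReal.ofReal_le_ofReal ?_
        rcases eq_or_ne h 0 with rfl | hh
        · simp only [abs_zero, mul_zero]
          positivity
        · have hp : 0 < |h| := abs_pos.2 hh
          rw [Real.rpow_add hp, Real.rpow_one, Real.rpow_neg hp.le]
          refine le_of_eq ?_
          field_simp
    _ = _ := lintegral_const_mul _ (by fun_prop)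

/-- The squared `L²` norm of a function of bounded variation. -/
lemma BoundedVariationOn.setIntegral_norm_sq_le {f : ℝ → ℂ} {T : ℝ} (hT : 0 ≤ T)
    (hf : BoundedVariationOn f (Icc 0 T)) :
    ∫ t in Ioo (0:ℝ) T, ‖f t‖ ^ 2
      ≤ T * (‖f 0‖ + (eVariationOn f (Icc 0 T)).toReal) ^ 2 := by
  have hle : ∀ t ∈ Ioo 0 T, ‖‖f t‖ ^ 2‖ ≤ (‖f 0‖ + (eVariationOn f (Icc 0 T)).toReal) ^ 2 := by
    intro t ht
    have hd := hf.dist_le (Ioo_subset_Icc_self ht) ⟨le_rfl, hT⟩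
    rw [dist_eq_norm] at hd
    rw [norm_pow, norm_norm]
    gcongr
    linarith [norm_le_norm_add_norm_sub' (f t) (f 0)]
  have := norm_setIntegral_le_of_norm_le_const (μ := volume) (by simp) hle
  rw [Real.volume_real_Ioo_of_le hT, sub_zero, mul_comm] at this
  exact (le_abs_self _).trans this

/-- **Lemma 7.2.** A complex-valued function of bounded variation on `[0,T]`
belongs to `H^β(0,T)` for every `β ∈ [0,1/2)`, with
`‖f‖_{H^β} ≤ C(β,T) (‖f‖_{L¹} + |f(0)| + |f(T)| + V_0^T(f))` for a constant `C(β,T)`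
independent of `f`. -/
theorem BV_mem_Hbeta (T : ℝ) (hT : 0 < T) (β : ℝ) (hβ0 : 0 ≤ β) (hβ : β < 1 / 2) :
    ∃ C > 0, ∀ f : ℝ → ℂ, Measurable f → BoundedVariationOn f (Icc 0 T) →
      (∫⁻ t in Ioo (0:ℝ) T, ∫⁻ s in Ioo (0:ℝ) T,
          ENNReal.ofReal (‖f t - f s‖ ^ 2 / |t - s| ^ (1 + 2 * β)) < ⊤) ∧
      Real.sqrt ((∫ t in Ioo (0:ℝ) T, ‖f t‖ ^ 2) +
          (∫⁻ t in Ioo (0:ℝ) T, ∫⁻ s in Ioo (0:ℝ) T,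
            ENNReal.ofReal (‖f t - f s‖ ^ 2 / |t - s| ^ (1 + 2 * β))).toReal)
        ≤ C * ((∫ t in Ioo (0:ℝ) T, ‖f t‖) + ‖f 0‖ + ‖f T‖ +
            (eVariationOn f (Icc 0 T)).toReal) := by
  have hK := lintegral_Ioo_neg_abs_rpow_lt_top T (r := -(2 * β)) (by linarith)
  set K := ∫⁻ h in Ioo (-T) T, ENNReal.ofReal (|h| ^ (-(2 * β)))
  have hK0 : 0 ≤ K.toReal := ENNReal.toReal_nonneg
  refine ⟨Real.sqrt (T + K.toReal), Real.sqrt_pos.2 (by linarith), fun f _ hf => ?_⟩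
  have hD := hf.lintegral_slobodeckij_le hT.le β
  have hfin := ENNReal.mul_lt_top ENNReal.ofReal_lt_top hK
    (a := ENNReal.ofReal ((eVariationOn f (Icc 0 T)).toReal ^ 2))
  refine ⟨hD.trans_lt hfin, ?_⟩
  have hDr := ENNReal.toReal_mono hfin.ne hD
  rw [ENNReal.toReal_mul, ENNReal.toReal_ofReal (by positivity)] at hDr
  have hL := hf.setIntegral_norm_sq_le hT.le
  have hI : 0 ≤ ∫ t in Ioo (0:ℝ) T, ‖f t‖ := integral_nonneg fun t => norm_nonneg _
  set V := (eVariationOn f (Icc 0 T)).toReal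
  have hV0 : 0 ≤ V := ENNReal.toReal_nonneg
  set S := (∫ t in Ioo (0:ℝ) T, ‖f t‖) + ‖f 0‖ + ‖f T‖ + V
  have hS1 : ‖f 0‖ + V ≤ S := by linarith [norm_nonneg (f T)]
  have hS2 : V ≤ S := by linarith [norm_nonneg (f 0)]
  have hS0 : 0 ≤ S := hV0.trans hS2
  rw [← Real.sqrt_sq hS0, ← Real.sqrt_mul (by positivity)]
  refine Real.sqrt_le_sqrt ?_
  calc _ ≤ T * (‖f 0‖ + V) ^ 2 + V ^ 2 * K.toReal := add_le_add hL hDr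
    _ ≤ T * S ^ 2 + S ^ 2 * K.toReal := by gcongr
    _ = (T + K.toReal) * S ^ 2 := by ring
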